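/- Let 0 < β < 1, α > 0, γ ∈ ℝ and λ ∈ ℝ, and define the coefficients c_{n,γ} = Σ_{m=0}^n (−1)^m (γ)_m/(m!(n−m)!) (the Taylor coefficients of eˣ(1+x)^{−γ}) and d_{n,γ} = Σ_{m=0}^n (−γ)_m/(m!(n−m)!) (so that Σₙ d_{n,γ}(−x)ⁿ = e^{−x}(1+x)^γ). Then the functions κ(x) = x^{β−1} Σₙ₌₀^∞ (c_{n,γ}/Γ(αn+β)) (λ x^α)ⁿ and k(x) = x^{−β} Σₙ₌₀^∞ (d_{n,γ}/Γ(αn+1−β)) (−λ x^α)ⁿ form a pair of Sonin kernels: for all x > 0, (κ * k)(x) = 1. -/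

import Mathlib

open MeasureTheory Real

/-- The Pochhammer symbol `(γ)ₙ = γ(γ+1)⋯(γ+n-1)`. -/
noncomputable def poch (γ : ℝ) (n : ℕ) : ℝ := ∏ i ∈ Finset.range n, (γ + i)

/-- The Beta integral over `[0, x]`, in terms of the real Gamma function. -/
theorem integral_sub_rpow_mul_rpow {s t x : ℝ} (hs : 0 < s) (ht : 0 < t) (hx : 0 < x) :
    ∫ ξ in (0 : ℝ)..x, (x - ξ) ^ (s - 1) * ξ ^ (t - 1) =
      x ^ (s + t - 1) * (Gamma s * Gamma t / Gamma (s + t)) := by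
  have key := Complex.betaIntegral_scaled (t : ℂ) (s : ℂ) hx
  rw [Complex.betaIntegral_eq_Gamma_mul_div _ _ (by simpa using ht) (by simpa using hs)] at key
  apply Complex.ofReal_injective
  rw [← intervalIntegral.integral_ofReal]
  have hcongr : ∫ ξ in (0 : ℝ)..x, (((x - ξ) ^ (s - 1) * ξ ^ (t - 1) : ℝ) : ℂ) =
      ∫ ξ in (0 : ℝ)..x, (ξ : ℂ) ^ ((t : ℂ) - 1) * ((x : ℂ) - ξ) ^ ((s : ℂ) - 1) := by
    refine intervalIntegral.integral_congr fun ξ hξ => ?_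
    rw [Set.uIcc_of_le hx.le] at hξ
    simp only [Complex.ofReal_mul]
    rw [Complex.ofReal_cpow (sub_nonneg.2 hξ.2), Complex.ofReal_cpow hξ.1]
    push_cast
    ring
  rw [hcongr, key]
  push_cast
  rw [Complex.ofReal_cpow hx.le, ← Complex.Gamma_ofReal, ← Complex.Gamma_ofReal,
    ← Complex.Gamma_ofReal]
  push_cast
  rw [add_comm (t : ℂ) s, mul_comm (Complex.Gamma t)]

theorem intervalIntegrable_sub_rpow_mul_rpow {s t x : ℝ} (hs : 0 < s) (ht : 0 < t) (hx : 0 < x) :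
    IntervalIntegrable (fun ξ : ℝ => (x - ξ) ^ (s - 1) * ξ ^ (t - 1)) volume 0 x := by
  by_contra h
  have h0 := intervalIntegral.integral_undef h
  rw [integral_sub_rpow_mul_rpow hs ht hx] at h0
  have := Gamma_pos_of_pos hs
  have := Gamma_pos_of_pos ht
  have := Gamma_pos_of_pos (add_pos hs ht)
  exact absurd h0 (by positivity)

/-- The Gamma function dominates every exponential. -/
theorem rpow_mul_exp_neg_le_Gamma {s T : ℝ} (hs : 1 ≤ s) (hT : 0 ≤ T) :
    T ^ (s - 1) * exp (-T) ≤ Gamma s := by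
  have hconv := GammaIntegral_convergent (zero_lt_one.trans_le hs)
  have hsub : Set.Ioi T ⊆ Set.Ioi 0 := Set.Ioi_subset_Ioi hT
  rw [Gamma_eq_integral (zero_lt_one.trans_le hs)]
  calc T ^ (s - 1) * exp (-T) = ∫ t in Set.Ioi T, T ^ (s - 1) * exp (-t) := by
        rw [integral_const_mul, integral_exp_neg_Ioi]
    _ ≤ ∫ t in Set.Ioi T, exp (-t) * t ^ (s - 1) := by
        refine setIntegral_mono_on ((integrableOn_exp_neg_Ioi T).const_mul _)
          (hconv.mono_set hsub) measurableSet_Ioi fun t ht => ?_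
        rw [mul_comm]
        gcongr
        exact le_of_lt ht
    _ ≤ ∫ t in Set.Ioi 0, exp (-t) * t ^ (s - 1) := by
        refine setIntegral_mono_set hconv ?_ hsub.eventuallyLE
        filter_upwards [ae_restrict_mem measurableSet_Ioi] with t ht
        have : (0 : ℝ) < t := ht
        positivity

theorem exists_pow_div_Gamma_le {a : ℝ} (b : ℝ) {R : ℝ} (ha : 0 < a) (hR : 0 ≤ R) :
    ∃ C : ℝ, ∀ n : ℕ, 1 ≤ a * n + b → R ^ n / Gamma (a * n + b) ≤ C * (1 / 2) ^ n := by
  set T : ℝ := (2 * (R + 1)) ^ (1 / a) with hTdef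
  have hTpos : 0 < T := by positivity
  have hTa : T ^ a = 2 * (R + 1) := by
    rw [hTdef, ← rpow_mul (by positivity), one_div_mul_cancel ha.ne', rpow_one]
  refine ⟨exp T / T ^ (b - 1), fun n hn => ?_⟩
  have hG := rpow_mul_exp_neg_le_Gamma hn hTpos.le
  have hsplit : T ^ (a * n + b - 1) = (2 * (R + 1)) ^ n * T ^ (b - 1) := by
    rw [add_sub_assoc, rpow_add hTpos, rpow_mul hTpos.le, hTa, rpow_natCast]
  rw [hsplit] at hG
  have hR1 : 0 < R + 1 := by linarith
  calc R ^ n / Gamma (a * n + b)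
      ≤ (R + 1) ^ n / ((2 * (R + 1)) ^ n * T ^ (b - 1) * exp (-T)) := by
        gcongr
        linarith
    _ = exp T / T ^ (b - 1) * (1 / 2) ^ n := by
        rw [exp_neg, mul_pow, div_pow, one_pow]
        field_simp

theorem summable_pow_div_Gamma {a b R : ℝ} (ha : 0 < a) (hb : 0 < b) (hR : 0 ≤ R) :
    Summable fun n : ℕ => R ^ n / Gamma (a * n + b) := by
  obtain ⟨C, hC⟩ := exists_pow_div_Gamma_le b ha hR
  refine Summable.of_norm_bounded_eventually_nat
    (summable_geometric_two.mul_left C) ?_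
  have hlim : Filter.Tendsto (fun n : ℕ => a * (n : ℝ) + b) Filter.atTop Filter.atTop :=
    Filter.tendsto_atTop_add_const_right _ _
      (tendsto_natCast_atTop_atTop.const_mul_atTop ha)
  filter_upwards [hlim.eventually_ge_atTop 1] with n hn
  have := Gamma_pos_of_pos (zero_lt_one.trans_le hn)
  rw [norm_of_nonneg (by positivity)]
  exact hC n hn

theorem summable_norm_div_Gamma_mul_pow {a b K : ℝ} {u : ℕ → ℝ} (ha : 0 < a) (hb : 0 < b)
    (hK : 0 ≤ K) (hu : ∀ n, |u n| ≤ K ^ n) (z : ℝ) :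
    Summable fun n : ℕ => ‖u n / Gamma (a * n + b) * z ^ n‖ := by
  refine Summable.of_nonneg_of_le (fun _ => norm_nonneg _) (fun n => ?_)
    (summable_pow_div_Gamma ha hb (mul_nonneg hK (abs_nonneg z)))
  have hG : 0 < Gamma (a * n + b) := Gamma_pos_of_pos (by positivity)
  rw [norm_mul, norm_div, norm_pow, norm_of_nonneg hG.le, mul_pow, norm_eq_abs, norm_eq_abs,
    div_mul_eq_mul_div]
  gcongr
  exact hu n

theorem summable_prod_pow_div_Gamma {a R : ℝ} (ha : 0 < a) (hR : 0 ≤ R) :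
    Summable fun p : ℕ × ℕ => R ^ (p.1 + p.2) / Gamma (a * (p.1 + p.2 : ℕ) + 1) := by
  obtain ⟨C, hC⟩ := exists_pow_div_Gamma_le 1 ha hR
  have hgeom : Summable fun p : ℕ × ℕ => C * ((1 / 2 : ℝ) ^ p.1 * (1 / 2) ^ p.2) :=
    (summable_geometric_two.mul_of_nonneg summable_geometric_two
      (fun _ => by positivity) (fun _ => by positivity)).mul_left C
  refine Summable.of_nonneg_of_le (fun p => ?_) (fun p => ?_) hgeom
  · exact div_nonneg (by positivity) (Gamma_nonneg_of_nonneg (by positivity))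
  · rw [← pow_add]
    exact hC _ (le_add_of_nonneg_left (by positivity))

/-- Power-type series whose coefficient sequences are inverse to each other under the Cauchy
product give rise to a pair of Sonin kernels. -/
theorem integral_mul_eq_one_of_antidiagonal {α β K x : ℝ} {a b : ℕ → ℝ} (hβ0 : 0 < β)
    (hβ1 : β < 1) (hα : 0 < α) (hK : 0 ≤ K) (ha : ∀ n, |a n| ≤ K ^ n) (hb : ∀ n, |b n| ≤ K ^ n)
    (hab : ∀ N : ℕ, ∑ p ∈ Finset.HasAntidiagonal.antidiagonal N, a p.1 * b p.2 =
      if N = 0 then 1 else 0)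
    (hx : 0 < x) :
    ∫ ξ in (0 : ℝ)..x,
      ((x - ξ) ^ (β - 1) * ∑' n : ℕ, a n / Gamma (α * n + β) * ((x - ξ) ^ α) ^ n) *
      (ξ ^ (-β) * ∑' n : ℕ, b n / Gamma (α * n + (1 - β)) * (ξ ^ α) ^ n) = 1 := by
  have hβ' : 0 < 1 - β := sub_pos.2 hβ1
  have hs : ∀ n : ℕ, 0 < α * n + β := fun n => by positivity
  have ht : ∀ n : ℕ, 0 < α * n + (1 - β) := fun n => by positivity
  set M : ℕ × ℕ → ℝ → ℝ := fun p ξ =>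
    (x - ξ) ^ (α * p.1 + β - 1) * ξ ^ (α * p.2 + (1 - β) - 1) with hM
  set w : ℕ × ℕ → ℝ := fun p =>
    a p.1 / Gamma (α * p.1 + β) * (b p.2 / Gamma (α * p.2 + (1 - β))) with hw
  have hMint : ∀ p, IntegrableOn (M p) (Set.Ioc 0 x) := fun p =>
    (intervalIntegrable_iff_integrableOn_Ioc_of_le hx.le).1
      (intervalIntegrable_sub_rpow_mul_rpow (hs p.1) (ht p.2) hx)
  have hMval : ∀ p : ℕ × ℕ, ∫ ξ in Set.Ioc 0 x, M p ξ = (x ^ α) ^ (p.1 + p.2) *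
      (Gamma (α * p.1 + β) * Gamma (α * p.2 + (1 - β)) / Gamma (α * (p.1 + p.2 : ℕ) + 1)) := by
    intro p
    rw [← intervalIntegral.integral_of_le hx.le,
      integral_sub_rpow_mul_rpow (hs p.1) (ht p.2) hx, ← rpow_natCast, ← rpow_mul hx.le]
    push_cast
    congr 2 <;> ring_nf
  have hMnorm : ∀ p : ℕ × ℕ, ∫ ξ in Set.Ioc 0 x, ‖w p * M p ξ‖ =
      |w p| * ∫ ξ in Set.Ioc 0 x, M p ξ := by
    intro p
    rw [← integral_const_mul]
    refine setIntegral_congr_fun measurableSet_Ioc fun ξ hξ => ?_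
    have h1 : 0 ≤ x - ξ := sub_nonneg.2 hξ.2
    have h2 : 0 ≤ ξ := hξ.1.le
    have h3 : 0 ≤ M p ξ := by simp only [hM]; positivity
    simp only [norm_mul, norm_eq_abs, abs_of_nonneg h3]
  have hsum : Summable fun p : ℕ × ℕ => ∫ ξ in Set.Ioc 0 x, ‖w p * M p ξ‖ := by
    refine Summable.of_nonneg_of_le (fun p => integral_nonneg fun _ => norm_nonneg _)
      (fun p => ?_) (summable_prod_pow_div_Gamma hα (mul_nonneg hK (rpow_nonneg hx.le α)))
    have hG1 := Gamma_pos_of_pos (hs p.1)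
    have hG2 := Gamma_pos_of_pos (ht p.2)
    have hG3 : 0 < Gamma (α * (p.1 + p.2 : ℕ) + 1) := Gamma_pos_of_pos (by positivity)
    rw [hMnorm, hMval, hw]
    simp only [abs_mul, abs_div, abs_of_pos hG1, abs_of_pos hG2]
    have hcoef : |a p.1| * |b p.2| ≤ K ^ (p.1 + p.2) := by
      rw [pow_add]
      exact mul_le_mul (ha _) (hb _) (abs_nonneg _) (by positivity)
    calc _ = |a p.1| * |b p.2| * (x ^ α) ^ (p.1 + p.2) / Gamma (α * (p.1 + p.2 : ℕ) + 1) := by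
          field_simp
      _ ≤ _ := by
          rw [mul_pow]
          gcongr
  have key := hasSum_integral_of_summable_integral_norm
    (F := fun p ξ => w p * M p ξ) (fun p => (hMint p).const_mul (w p)) hsum
  have hval : ∀ p : ℕ × ℕ, ∫ ξ in Set.Ioc 0 x, w p * M p ξ =
      a p.1 * b p.2 * ((x ^ α) ^ (p.1 + p.2) / Gamma (α * (p.1 + p.2 : ℕ) + 1)) := by
    intro p
    have hG1 := Gamma_pos_of_pos (hs p.1)
    have hG2 := Gamma_pos_of_pos (ht p.2)
    rw [integral_const_mul, hMval, hw]
    field_simp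
  have hpoint : ∫ ξ in Set.Ioc 0 x,
      ((x - ξ) ^ (β - 1) * ∑' n : ℕ, a n / Gamma (α * n + β) * ((x - ξ) ^ α) ^ n) *
      (ξ ^ (-β) * ∑' n : ℕ, b n / Gamma (α * n + (1 - β)) * (ξ ^ α) ^ n) =
      ∫ ξ in Set.Ioc 0 x, ∑' p, w p * M p ξ := by
    rw [integral_Ioc_eq_integral_Ioo, integral_Ioc_eq_integral_Ioo]
    refine setIntegral_congr_fun measurableSet_Ioo fun ξ hξ => ?_
    have h1 : 0 < x - ξ := sub_pos.2 hξ.2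
    have h2 : 0 < ξ := hξ.1
    rw [mul_mul_mul_comm, tsum_mul_tsum_of_summable_norm
      (summable_norm_div_Gamma_mul_pow hα hβ0 hK ha _)
      (summable_norm_div_Gamma_mul_pow hα hβ' hK hb _), ← tsum_mul_left]
    refine tsum_congr fun p => ?_
    have e1 : (x - ξ) ^ (α * p.1 + β - 1) = ((x - ξ) ^ α) ^ p.1 * (x - ξ) ^ (β - 1) := by
      rw [add_sub_assoc, rpow_add h1, rpow_mul h1.le, rpow_natCast]
    have e2 : ξ ^ (α * p.2 + (1 - β) - 1) = (ξ ^ α) ^ p.2 * ξ ^ (-β) := by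
      rw [show α * p.2 + (1 - β) - 1 = α * p.2 + -β by ring, rpow_add h2, rpow_mul h2.le,
        rpow_natCast]
    simp only [hM, hw, e1, e2]
    ring
  rw [intervalIntegral.integral_of_le hx.le, hpoint]
  simp only [hval] at key
  rw [← key.tsum_eq, ← Finset.HasAntidiagonal.sigmaAntidiagonalEquivProd.tsum_eq]
  have hsig := Finset.HasAntidiagonal.sigmaAntidiagonalEquivProd.summable_iff.2 key.summable
  refine (hsig.tsum_sigma' fun _ => (hasSum_fintype _).summable).trans ?_
  rw [tsum_eq_single 0]
  · simpa using hab 0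
  · intro N hN
    rw [tsum_fintype, Finset.univ_eq_attach]
    have h0 := hab N
    rw [if_neg hN] at h0
    have : ∀ p ∈ Finset.HasAntidiagonal.antidiagonal N,
        a p.1 * b p.2 * ((x ^ α) ^ (p.1 + p.2) / Gamma (α * (p.1 + p.2 : ℕ) + 1)) =
        a p.1 * b p.2 * ((x ^ α) ^ N / Gamma (α * N + 1)) := by
      intro p hp
      rw [Finset.HasAntidiagonal.mem_antidiagonal.1 hp]
    refine (Finset.sum_attach (Finset.HasAntidiagonal.antidiagonal N) fun p =>
      a p.1 * b p.2 * ((x ^ α) ^ (p.1 + p.2) / Gamma (α * (p.1 + p.2 : ℕ) + 1))).trans ?_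
    rw [Finset.sum_congr rfl this, ← Finset.sum_mul, h0, zero_mul]

theorem ringChoose_neg_eq_poch (r : ℝ) (n : ℕ) :
    Ring.choose (-r) n = (-1) ^ n * poch r n / n.factorial := by
  have h : (descPochhammer ℤ n).smeval (-r) = (-1) ^ n * poch r n := by
    induction n with
    | zero => simp [poch]
    | succ n ih =>
      rw [descPochhammer_succ_right, Polynomial.smeval_mul, ih, poch, poch, Finset.prod_range_succ,
        pow_succ, Polynomial.smeval_sub, Polynomial.smeval_X, Polynomial.smeval_natCast]
      simp
      ring
  rw [Ring.descPochhammer_eq_factorial_smul_choose, nsmul_eq_mul] at h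
  have : (n.factorial : ℝ) ≠ 0 := by positivity
  field_simp
  linarith

theorem abs_poch_div_factorial_le (r : ℝ) (n : ℕ) :
    |poch r n| / n.factorial ≤ (|r| + 1) ^ n := by
  induction n with
  | zero => simp [poch]
  | succ n ih =>
    rw [poch, Finset.prod_range_succ, ← poch, abs_mul, Nat.factorial_succ, mul_comm (n + 1),
      Nat.cast_mul, mul_div_mul_comm, pow_succ]
    refine mul_le_mul ih ?_ (by positivity) (by positivity)
    rw [div_le_iff₀ (by positivity)]
    push_cast
    have := abs_add_le r n
    rw [Nat.abs_cast] at this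
    nlinarith [abs_nonneg r, (Nat.cast_nonneg n : (0 : ℝ) ≤ n)]

theorem abs_sum_div_factorial_le {u : ℕ → ℝ} {r : ℝ}
    (hu : ∀ m, |u m| = |poch r m|) (n : ℕ) :
    |∑ m ∈ Finset.range (n + 1), u m / ((m.factorial : ℝ) * ((n - m).factorial : ℝ))| ≤
      (2 * (|r| + 1)) ^ n := by
  have hterm : ∀ m ∈ Finset.range (n + 1),
      |u m / ((m.factorial : ℝ) * ((n - m).factorial : ℝ))| ≤ (|r| + 1) ^ n := by
    intro m hm
    have hfac : (1 : ℝ) ≤ (n - m).factorial := by exact_mod_cast Nat.factorial_pos _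
    rw [abs_div, hu, abs_of_pos (by positivity : (0 : ℝ) < m.factorial * (n - m).factorial),
      ← div_div]
    calc _ ≤ |poch r m| / m.factorial := div_le_self (by positivity) hfac
      _ ≤ (|r| + 1) ^ m := abs_poch_div_factorial_le r m
      _ ≤ (|r| + 1) ^ n := pow_le_pow_right₀ (by linarith [abs_nonneg r])
          (Nat.lt_succ_iff.1 (Finset.mem_range.1 hm))
  calc _ ≤ ∑ m ∈ Finset.range (n + 1),
        |u m / ((m.factorial : ℝ) * ((n - m).factorial : ℝ))| := Finset.abs_sum_le_sum_abs _ _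
    _ ≤ (n + 1 : ℕ) * (|r| + 1) ^ n := by
        simpa using Finset.sum_le_sum hterm
    _ ≤ (2 * (|r| + 1)) ^ n := by
        rw [mul_pow]
        gcongr
        exact_mod_cast Nat.lt_two_pow_self

/-- The Taylor coefficients of `eˣ(1+x)^{-γ}` and of `e^{-x}(1+x)^γ` are inverse to each other
under the Cauchy product. -/
theorem sum_antidiagonal_mul_eq_ite {γ : ℝ} {c d : ℕ → ℝ}
    (hc : ∀ n : ℕ, c n = ∑ m ∈ Finset.range (n + 1),
      (-1 : ℝ) ^ m * poch γ m / ((m.factorial : ℝ) * ((n - m).factorial : ℝ)))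
    (hd : ∀ n : ℕ, d n = ∑ m ∈ Finset.range (n + 1),
      poch (-γ) m / ((m.factorial : ℝ) * ((n - m).factorial : ℝ))) (N : ℕ) :
    ∑ p ∈ Finset.HasAntidiagonal.antidiagonal N, c p.1 * ((-1) ^ p.2 * d p.2) =
      if N = 0 then 1 else 0 := by
  have hC : PowerSeries.mk c =
      PowerSeries.binomialSeries ℝ (-γ) * PowerSeries.exp ℝ := by
    ext n
    rw [PowerSeries.coeff_mk, hc, PowerSeries.coeff_mul,
      Finset.Nat.sum_antidiagonal_eq_sum_range_succ_mk]
    refine Finset.sum_congr rfl fun m _ => ?_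
    simp only [PowerSeries.binomialSeries_coeff, PowerSeries.coeff_exp, ringChoose_neg_eq_poch,
      smul_eq_mul, mul_one, map_div₀, map_one, map_natCast]
    field_simp
  have hD : PowerSeries.mk (fun n => (-1) ^ n * d n) =
      PowerSeries.binomialSeries ℝ γ * PowerSeries.evalNegHom (PowerSeries.exp ℝ) := by
    ext n
    rw [PowerSeries.coeff_mk, hd, PowerSeries.coeff_mul,
      Finset.Nat.sum_antidiagonal_eq_sum_range_succ_mk, Finset.mul_sum]
    refine Finset.sum_congr rfl fun m hm => ?_
    have hsgn : (-1 : ℝ) ^ n = (-1) ^ m * (-1) ^ (n - m) := by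
      rw [← pow_add, Nat.add_sub_cancel' (Nat.lt_succ_iff.1 (Finset.mem_range.1 hm))]
    have hchoose := ringChoose_neg_eq_poch (-γ) m
    rw [neg_neg] at hchoose
    simp only [PowerSeries.binomialSeries_coeff, PowerSeries.evalNegHom,
      PowerSeries.coeff_rescale, PowerSeries.coeff_exp, hchoose,
      smul_eq_mul, mul_one, map_div₀, map_one, map_natCast, hsgn]
    field_simp
  have hCD : PowerSeries.mk c * PowerSeries.mk (fun n => (-1) ^ n * d n) = 1 := by
    rw [hC, hD, mul_mul_mul_comm, ← PowerSeries.binomialSeries_add, neg_add_cancel,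
      PowerSeries.binomialSeries_zero, PowerSeries.exp_mul_exp_neg_eq_one, one_mul]
  have := congrArg (PowerSeries.coeff N) hCD
  simpa [PowerSeries.coeff_mul, PowerSeries.coeff_one] using this

/-- The kernels built from the Taylor coefficients `c_{n,γ}` of `eˣ(1+x)^{-γ}` and
`d_{n,γ}` of `e^{-x}(1+x)^{γ}` (in `-x`) form a pair of Sonin kernels. -/
theorem exp_binomial_kernels_sonin (α β γ lam : ℝ) (hβ0 : 0 < β) (hβ1 : β < 1) (hα : 0 < α)
    (c d : ℕ → ℝ)
    (hc : ∀ n : ℕ, c n = ∑ m ∈ Finset.range (n + 1),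
      (-1 : ℝ) ^ m * poch γ m / ((m.factorial : ℝ) * ((n - m).factorial : ℝ)))
    (hd : ∀ n : ℕ, d n = ∑ m ∈ Finset.range (n + 1),
      poch (-γ) m / ((m.factorial : ℝ) * ((n - m).factorial : ℝ)))
    (x : ℝ) (hx : 0 < x) :
    ∫ ξ in (0:ℝ)..x,
      ((x - ξ) ^ (β - 1) * ∑' n : ℕ, c n / Real.Gamma (α * n + β) * (lam * (x - ξ) ^ α) ^ n) *
      (ξ ^ (-β) * ∑' n : ℕ, d n / Real.Gamma (α * n + 1 - β) * (-(lam * ξ ^ α)) ^ n) = 1 := by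
  have hcb : ∀ n, |c n * lam ^ n| ≤ (2 * (|γ| + 1) * |lam|) ^ n := fun n => by
    rw [abs_mul, abs_pow, mul_pow _ |lam|, hc]
    gcongr
    exact abs_sum_div_factorial_le (fun m => by simp [abs_mul]) n
  have hdb : ∀ n, |(-1) ^ n * d n * lam ^ n| ≤ (2 * (|γ| + 1) * |lam|) ^ n := fun n => by
    rw [abs_mul, abs_mul, abs_pow, abs_pow, abs_neg, abs_one, one_pow, one_mul,
      mul_pow _ |lam|, hd, ← abs_neg γ]
    gcongr
    exact abs_sum_div_factorial_le (fun _ => rfl) n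
  have hprod : ∀ N : ℕ, ∑ p ∈ Finset.HasAntidiagonal.antidiagonal N,
      (c p.1 * lam ^ p.1) * ((-1) ^ p.2 * d p.2 * lam ^ p.2) = if N = 0 then 1 else 0 := by
    intro N
    have hterm : ∀ p ∈ Finset.HasAntidiagonal.antidiagonal N,
        (c p.1 * lam ^ p.1) * ((-1) ^ p.2 * d p.2 * lam ^ p.2) =
        c p.1 * ((-1) ^ p.2 * d p.2) * lam ^ N := by
      intro p hp
      rw [← Finset.HasAntidiagonal.mem_antidiagonal.1 hp, pow_add]
      ring
    rw [Finset.sum_congr rfl hterm, ← Finset.sum_mul, sum_antidiagonal_mul_eq_ite hc hd]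
    split_ifs with hN <;> simp [hN]
  refine Eq.trans (intervalIntegral.integral_congr fun ξ _ => ?_)
    (integral_mul_eq_one_of_antidiagonal hβ0 hβ1 hα (by positivity) hcb hdb hprod hx)
  have hκ : ∀ n : ℕ, c n / Gamma (α * n + β) * (lam * (x - ξ) ^ α) ^ n =
      c n * lam ^ n / Gamma (α * n + β) * ((x - ξ) ^ α) ^ n := fun n => by
    rw [mul_pow]
    ring
  have hk : ∀ n : ℕ, d n / Gamma (α * n + 1 - β) * (-(lam * ξ ^ α)) ^ n =
      (-1) ^ n * d n * lam ^ n / Gamma (α * n + (1 - β)) * (ξ ^ α) ^ n := fun n => by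
    rw [neg_pow, mul_pow, add_sub_assoc]
    ring
  simp only [hκ, hk]
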